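/- Let X be a nonempty second-countable Baire topological space and let T be a nonempty collection of continuous self-maps of X that is closed under composition. Assume that for all nonempty open subsets U, V of X there exists f ∈ T with f(U) ∩ V ≠ ∅. Then there exists a point x ∈ X whose T-orbit {f(x) : f ∈ T} is dense in X. -/

import Mathlib

/-- A composition-closed family of continuous self-maps of a nonempty second-countable
Baire space that is topologically transitive has a point with dense orbit. -/
theorem stmt_7 {X : Type*} [TopologicalSpace X] [Nonempty X]
    [SecondCountableTopology X] [BaireSpace X]
    (T : Set (X → X)) (hTne : T.Nonempty) (hcont : ∀ f ∈ T, Continuous f)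
    (hcomp : ∀ f ∈ T, ∀ g ∈ T, f ∘ g ∈ T)
    (htrans : ∀ U V : Set X, IsOpen U → IsOpen V → U.Nonempty → V.Nonempty →
      ∃ f ∈ T, (f '' U ∩ V).Nonempty) :
    ∃ x : X, Dense {y : X | ∃ f ∈ T, f x = y} := by
  have hB := TopologicalSpace.isBasis_countableBasis X
  have hdense : Dense (⋂ V ∈ TopologicalSpace.countableBasis X, ⋃ f ∈ T, f ⁻¹' V) := by
    refine dense_biInter_of_isOpen
      (fun V hV => isOpen_biUnion fun f hf => (hB.isOpen hV).preimage (hcont f hf))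
      (TopologicalSpace.countable_countableBasis X) fun V hV => ?_
    refine dense_iff_inter_open.2 fun U hU hUne => ?_
    obtain ⟨f, hf, _, ⟨x, hxU, rfl⟩, hxV⟩ := htrans U V hU (hB.isOpen hV) hUne
      (TopologicalSpace.nonempty_of_mem_countableBasis hV)
    exact ⟨x, hxU, Set.mem_biUnion hf hxV⟩
  obtain ⟨x, hx⟩ := hdense.nonempty
  refine ⟨x, hB.dense_iff.2 fun V hV _ => ?_⟩
  obtain ⟨f, hf, hfx⟩ := Set.mem_iUnion₂.1 (Set.mem_iInter₂.1 hx V hV)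
  exact ⟨f x, hfx, f, hf, rfl⟩
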